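/- Let A = {1,…,k} with k ≥ 3, let λ = {λ_1,…,λ_l} be a partition of A, and let S be the generating set from Theorem LmConsGeneration: (1) τ_{a,b} for all 1 ≤ i ≤ l and all a ≠ b ∈ λ_i; (2) τ_{aa,ab} for each 1 ≤ i ≤ l with |λ_i| > 1 and one chosen pair a ≠ b ∈ λ_i; (3) 1-SWAP_{a,b} for each 1 ≤ i < j ≤ l and one chosen pair a ∈ λ_i, b ∈ λ_j. Then S generates CONS, the class of all conservative gates, i.e. CONS ⊆ ⟨S⟩. -/

import Mathlib

/-- A reversible gate function of arity `n` over alphabet `A`: a bijection `A^n → A^n`. -/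
abbrev GateFun (A : Type*) (n : ℕ) := (Fin n → A) ≃ (Fin n → A)

/-- A reversible gate over alphabet `A`: an arity together with a bijection of that arity. -/
abbrev Gate (A : Type*) := Σ n : ℕ, GateFun A n

/-- The canonical identification `A^{n+m} ≃ A^n × A^m`. -/
def splitEquiv (A : Type*) (n m : ℕ) :
    (Fin (n + m) → A) ≃ ((Fin n → A) × (Fin m → A)) :=
  (Equiv.arrowCongr finSumFinEquiv.symm (Equiv.refl A)).trans
    (Equiv.sumArrowEquivProdArrow _ _ A)

/-- The permutation gate `P_σ`, mapping `(a_1,…,a_n)` to `(a_{σ(1)},…,a_{σ(n)})`. -/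
def permGate (A : Type*) {n : ℕ} (σ : Equiv.Perm (Fin n)) : GateFun A n :=
  Equiv.arrowCongr σ.symm (Equiv.refl A)

/-- Tensor product of gates. -/
def tensorGate {A : Type*} {n m : ℕ} (F : GateFun A n) (G : GateFun A m) :
    GateFun A (n + m) :=
  ((splitEquiv A n m).trans (F.prodCongr G)).trans (splitEquiv A n m).symm

/-- The generation relation: `Generates S g` means `g` can be generated from the set `S`
of reversible gates using the permutation, tensor product, composition and ancilla rules. -/
inductive Generates {A : Type*} (S : Set (Gate A)) : Gate A → Prop
  | mem {g : Gate A} : g ∈ S → Generates S g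
  | perm (n : ℕ) (σ : Equiv.Perm (Fin n)) : Generates S ⟨n, permGate A σ⟩
  | tensor {n m : ℕ} {F : GateFun A n} {G : GateFun A m} :
      Generates S ⟨n, F⟩ → Generates S ⟨m, G⟩ → Generates S ⟨n + m, tensorGate F G⟩
  | comp {n : ℕ} {F G : GateFun A n} :
      Generates S ⟨n, F⟩ → Generates S ⟨n, G⟩ → Generates S ⟨n, G.trans F⟩
  | ancilla {l m : ℕ} {F : GateFun A (l + m)} (a : Fin l → A) {F' : GateFun A m} :
      Generates S ⟨l + m, F⟩ →
      (∀ b : Fin m → A,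
        F ((splitEquiv A l m).symm (a, b)) = (splitEquiv A l m).symm (a, F' b)) →
      Generates S ⟨m, F'⟩

/-- The gate class `⟨S⟩` generated by a set `S` of reversible gates. -/
def genClosure {A : Type*} (S : Set (Gate A)) : Set (Gate A) := {g | Generates S g}

/-- A reversible gate class: a set of gates closed under the generation rules. -/
def IsGateClass {A : Type*} (S : Set (Gate A)) : Prop := ∀ g, Generates S g → g ∈ S

/-- The transposition gate `τ_{u,v}` exchanging the inputs `u` and `v`. -/
def tau {A : Type*} [DecidableEq A] {n : ℕ} (u v : Fin n → A) : GateFun A n :=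
  Equiv.swap u v

/-- The controlled gate `w-F`, mapping `w u` to `w F(u)` and fixing all other inputs. -/
def controlled {A : Type*} [DecidableEq A] {l n : ℕ} (w : Fin l → A) (F : GateFun A n) :
    GateFun A (l + n) :=
  ((splitEquiv A l n).trans
    (Equiv.prodCongrRight fun p => if p = w then F else Equiv.refl _)).trans
    (splitEquiv A l n).symm

/-- `SWAP_{a,b}` for single symbols `a`, `b`: exchanges `ab` and `ba`. -/
def swapGate {A : Type*} [DecidableEq A] (a b : A) : GateFun A 2 :=
  tau ![a, b] ![b, a]

/-- Number of occurrences of the symbol `a` in the string `x`. -/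
def countOf {A : Type*} [DecidableEq A] {n : ℕ} (a : A) (x : Fin n → A) : ℕ :=
  (Finset.univ.filter fun i => x i = a).card

section GeneratesOn

variable {A : Type*} {S : Set (Gate A)} {ι κ : Type}

/-- `GeneratesOn S f` means that the map `f` on strings indexed by the finite type `ι` becomes,
after numbering the wires, a gate generated by `S`. -/
def GeneratesOn (S : Set (Gate A)) (f : (ι → A) → ι → A) : Prop :=
  ∃ (n : ℕ) (e : ι ≃ Fin n) (F : GateFun A n),
    Generates S ⟨n, F⟩ ∧ ∀ x, f x = F (x ∘ e.symm) ∘ e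

theorem permGate_apply {n : ℕ} (σ : Equiv.Perm (Fin n)) (x : Fin n → A) :
    permGate A σ x = x ∘ σ := rfl

theorem splitEquiv_symm_apply {n m : ℕ} (y : Fin n → A) (z : Fin m → A) (s : Fin n ⊕ Fin m) :
    (splitEquiv A n m).symm (y, z) (finSumFinEquiv s) = Sum.elim y z s := by
  simp only [splitEquiv, Equiv.symm_trans_apply]
  cases s <;> simp [Equiv.sumArrowEquivProdArrow]

theorem Generates.generatesOn {n : ℕ} {F : GateFun A n} (h : Generates S ⟨n, F⟩) :
    GeneratesOn S F :=
  ⟨n, Equiv.refl _, F, h, fun _ => rfl⟩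

/-- The numbering of the wires is irrelevant. -/
theorem GeneratesOn.exists_gate {f : (ι → A) → ι → A} (h : GeneratesOn S f) {n : ℕ}
    (e : ι ≃ Fin n) :
    ∃ F : GateFun A n, Generates S ⟨n, F⟩ ∧ ∀ x, f x = F (x ∘ e.symm) ∘ e := by
  obtain ⟨m, e', F, hF, hf⟩ := h
  obtain rfl : m = n := by
    simpa using Fintype.card_congr (e'.symm.trans e)
  refine ⟨_, ((Generates.perm m (e.symm.trans e')).comp hF).comp
    (Generates.perm m (e'.symm.trans e)), fun x => ?_⟩
  rw [hf]
  funext i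
  simp only [Equiv.trans_apply, permGate_apply, Function.comp_apply, Equiv.symm_apply_apply]
  congr! 2
  funext j
  simp

theorem GeneratesOn.generates {n : ℕ} {F : GateFun A n} (h : GeneratesOn S F) :
    Generates S ⟨n, F⟩ := by
  obtain ⟨G, hG, hF⟩ := h.exists_gate (Equiv.refl _)
  obtain rfl : F = G := Equiv.ext hF
  exact hG

theorem GeneratesOn.comp {f g : (ι → A) → ι → A} (hf : GeneratesOn S f)
    (hg : GeneratesOn S g) : GeneratesOn S (f ∘ g) := by
  obtain ⟨n, e, F, hF, hf⟩ := hf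
  obtain ⟨G, hG, hg⟩ := hg.exists_gate e
  refine ⟨n, e, _, hF.comp hG, fun x => ?_⟩
  simp [hf, hg, Function.comp_assoc]

theorem GeneratesOn.id [Finite ι] : GeneratesOn S (id : (ι → A) → ι → A) := by
  obtain ⟨n, ⟨e⟩⟩ := Finite.exists_equiv_fin ι
  refine ⟨n, e, _, Generates.perm n 1, fun x => ?_⟩
  funext i
  simp [permGate_apply]

theorem GeneratesOn.injective {f : (ι → A) → ι → A} (hf : GeneratesOn S f) :
    Function.Injective f := by
  obtain ⟨n, e, F, -, hf⟩ := hf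
  intro x y hxy
  rw [hf, hf] at hxy
  exact e.symm.surjective.injective_comp_right (F.injective (e.surjective.injective_comp_right hxy))

/-- A generated map may be applied to some of the wires. -/
theorem GeneratesOn.extend [Finite ι] {f : (κ → A) → κ → A} (hf : GeneratesOn S f)
    {j : κ → ι} (hj : Function.Injective j) :
    GeneratesOn S fun x : ι → A => Function.extend j (f (x ∘ j)) x := by
  classical
  obtain ⟨n, e, F, hF, hf⟩ := hf
  obtain ⟨m, ⟨e'⟩⟩ := Finite.exists_equiv_fin ↥(Set.range j)ᶜ
  let E : κ ⊕ ↥(Set.range j)ᶜ ≃ ι :=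
    ((Equiv.ofInjective j hj).sumCongr (Equiv.refl _)).trans (Equiv.Set.sumCompl _)
  have hEl : ∀ k, E (Sum.inl k) = j k := fun k => by simp [E]
  have hEr : ∀ r, E (Sum.inr r) = r := fun r => by simp [E]
  refine ⟨n + m, E.symm.trans ((e.sumCongr e').trans finSumFinEquiv), _,
    hF.tensor (Generates.perm m 1), fun x => ?_⟩
  funext i
  obtain ⟨s, rfl⟩ := E.surjective i
  simp only [tensorGate, Equiv.trans_apply, Function.comp_apply, Equiv.symm_apply_apply]
  have hsplit : splitEquiv A n m (x ∘ (E.symm.trans ((e.sumCongr e').trans finSumFinEquiv)).symm)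
      = ((x ∘ j) ∘ e.symm, x ∘ Subtype.val ∘ e'.symm) := by
    rw [← Equiv.eq_symm_apply]
    funext t
    obtain ⟨t, rfl⟩ := finSumFinEquiv.surjective t
    rw [splitEquiv_symm_apply]
    rcases t with t | t <;> simp [← hEl, ← hEr]
  rw [hsplit, Equiv.prodCongr_apply, Prod.map_apply, splitEquiv_symm_apply]
  rcases s with s | s
  · simp [hEl, hj.extend_apply, hf]
  · rw [hEr, Function.extend_apply' _ _ _ s.2]
    simp [permGate_apply]

/-- The string on `Option ι` extending `x` by the symbol `d` on the ancilla wire `none`. -/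
def withAncilla (d : A) (x : ι → A) : Option ι → A := fun o => o.elim d x

@[simp] theorem withAncilla_none (d : A) (x : ι → A) : withAncilla d x none = d := rfl

@[simp] theorem withAncilla_some (d : A) (x : ι → A) (i : ι) :
    withAncilla d x (some i) = x i := rfl

/-- The ancilla rule. -/
theorem GeneratesOn.ancilla [Finite A] [Finite ι] {f : (Option ι → A) → Option ι → A}
    {g : (ι → A) → ι → A} (d : A) (hf : GeneratesOn S f)
    (h : ∀ x, f (withAncilla d x) = withAncilla d (g x)) : GeneratesOn S g := by
  classical
  have hg : Function.Injective g := fun x y hxy => by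
    have := hf.injective ((h x).trans ((congrArg _ hxy).trans (h y).symm))
    funext i
    exact congrFun this (some i)
  obtain ⟨m, ⟨e⟩⟩ := Finite.exists_equiv_fin ι
  let E : Option ι ≃ Fin (1 + m) := (Equiv.optionEquivSumPUnit.{0, 0} ι).trans
    (((Equiv.sumComm _ _).trans ((Equiv.ofUnique PUnit (Fin 1)).sumCongr e)).trans
      finSumFinEquiv)
  have hEn : E none = finSumFinEquiv (Sum.inl 0) := rfl
  have hEs : ∀ i, E (some i) = finSumFinEquiv (Sum.inr (e i)) := fun i => rfl
  have key : ∀ x : Fin m → A,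
      (splitEquiv A 1 m).symm (fun _ => d, x) = withAncilla d (x ∘ e) ∘ E.symm := fun x => by
    rw [← Equiv.comp_symm_eq, Equiv.symm_symm]
    funext o
    rcases o with _ | i
    · rw [Function.comp_apply, hEn, splitEquiv_symm_apply]; rfl
    · rw [Function.comp_apply, hEs, splitEquiv_symm_apply]; rfl
  obtain ⟨F, hF, hf⟩ := hf.exists_gate E
  have hg' : Function.Injective fun x : Fin m → A => g (x ∘ e) ∘ e.symm := fun x y hxy =>
    e.surjective.injective_comp_right (hg (e.symm.surjective.injective_comp_right hxy))
  refine ⟨m, e, Equiv.ofBijective _ (Finite.injective_iff_bijective.mp hg'),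
    Generates.ancilla (fun _ => d) hF fun x => ?_, fun x => ?_⟩
  · rw [key, key]
    have := hf (withAncilla d (x ∘ e))
    rw [h] at this
    have h2 := (Equiv.eq_comp_symm E _ _).mpr this.symm
    rw [h2, Equiv.ofBijective_apply, Function.comp_assoc, e.symm_comp_self, Function.comp_id]
  · funext i
    simp [Function.comp_assoc]

/-- The group of all permutations of `ι → A` generated by `S`. -/
def generatedSubgroup (S : Set (Gate A)) (ι : Type) [Finite A] [Finite ι] :
    Subgroup (Equiv.Perm (ι → A)) :=
  { carrier := {F | GeneratesOn S F}
    mul_mem' := fun {F G} (hF : GeneratesOn S F) (hG : GeneratesOn S G) => hF.comp hG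
    one_mem' := GeneratesOn.id
    inv_mem' := fun {F} hF => by
      have hpow : ∀ n : ℕ, GeneratesOn S ⇑(F ^ n) := fun n => by
        induction n with
        | zero => exact GeneratesOn.id
        | succ n ih => rw [pow_succ]; exact ih.comp hF
      obtain ⟨n, hn⟩ : F⁻¹ ∈ Submonoid.powers F :=
        mem_powers_iff_mem_zpowers.mpr (inv_mem (Subgroup.mem_zpowers F))
      exact hn ▸ hpow n }

/-- A permutation is generated as soon as all transpositions along its orbits are. -/
theorem generatesOn_of_swap [Finite A] [Finite ι] [DecidableEq (ι → A)] {F : Equiv.Perm (ι → A)}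
    (h : ∀ x, GeneratesOn S (Equiv.swap x (F x))) : GeneratesOn S F := by
  let T : Set (Equiv.Perm (ι → A)) := {σ | σ.IsSwap ∧ GeneratesOn S σ}
  have hT : Subgroup.closure T ≤ generatedSubgroup S ι :=
    (Subgroup.closure_le _).mpr fun σ hσ => hσ.2
  refine hT ((mem_closure_isSwap fun σ hσ => hσ.1).mpr ⟨Set.toFinite _, fun x => ?_⟩)
  by_cases hx : x = F x
  · rw [← hx]
    exact MulAction.mem_orbit_self x
  · exact ⟨⟨Equiv.swap x (F x), Subgroup.subset_closure ⟨⟨x, F x, hx, rfl⟩, h x⟩⟩,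
      Equiv.swap_apply_left _ _⟩

theorem GeneratesOn.swap_trans [Finite A] [Finite ι] [DecidableEq (ι → A)] {x y z : ι → A}
    (hxy : GeneratesOn S (Equiv.swap x y)) (hyz : GeneratesOn S (Equiv.swap y z)) :
    GeneratesOn S (Equiv.swap x z) :=
  SubmonoidClass.swap_mem_trans (generatedSubgroup S ι) hxy hyz

theorem generatesOn_swap_self [Finite ι] [DecidableEq (ι → A)] (x : ι → A) :
    GeneratesOn S (Equiv.swap x x) := by
  rw [Equiv.swap_self]
  exact GeneratesOn.id

end GeneratesOn

section ControlledMaps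

open Function

variable {A : Type*} {S : Set (Gate A)} {ι : Type}

open Classical in
/-- Exchange the wires `p` and `q` if they carry the symbols `a` and `b` in some order and the
whole string satisfies `P`. -/
noncomputable def swapIf (P : (ι → A) → Prop) (p q : ι) (a b : A) (x : ι → A) : ι → A :=
  if P x ∧ (x p = a ∧ x q = b ∨ x p = b ∧ x q = a) then x ∘ Equiv.swap p q else x

open Classical in
/-- Apply `h` to the wire `p` if the whole string satisfies `P`. -/
noncomputable def permIf (P : (ι → A) → Prop) (p : ι) (h : Equiv.Perm A) (x : ι → A) : ι → A :=
  if P x then update x p (h (x p)) else x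

theorem swapIf_of_pos [DecidableEq ι] {P : (ι → A) → Prop} {p q : ι} {a b : A} {x : ι → A}
    (h : P x ∧ (x p = a ∧ x q = b ∨ x p = b ∧ x q = a)) :
    swapIf P p q a b x = x ∘ Equiv.swap p q := by
  rw [swapIf, if_pos h]
  congr!

theorem swapIf_of_neg {P : (ι → A) → Prop} {p q : ι} {a b : A} {x : ι → A}
    (h : ¬(P x ∧ (x p = a ∧ x q = b ∨ x p = b ∧ x q = a))) : swapIf P p q a b x = x :=
  if_neg h

theorem permIf_of_pos [DecidableEq ι] {P : (ι → A) → Prop} {p : ι} {h : Equiv.Perm A}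
    {x : ι → A} (hx : P x) : permIf P p h x = update x p (h (x p)) := by
  rw [permIf, if_pos hx]
  congr!

theorem permIf_of_neg {P : (ι → A) → Prop} {p : ι} {h : Equiv.Perm A} {x : ι → A}
    (hx : ¬P x) : permIf P p h x = x :=
  if_neg hx

theorem swapIf_comm (P : (ι → A) → Prop) (p q : ι) (a b : A) :
    swapIf P p q a b = swapIf P p q b a := by
  classical
  funext x
  by_cases h : P x ∧ (x p = a ∧ x q = b ∨ x p = b ∧ x q = a)
  · rw [swapIf_of_pos h, swapIf_of_pos (h.imp_right Or.symm)]
  · rw [swapIf_of_neg h, swapIf_of_neg (fun h' => h (h'.imp_right Or.symm))]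

theorem swapIf_congr {P Q : (ι → A) → Prop} {p q : ι} {a b : A} {x : ι → A}
    (h : P x ↔ Q x) : swapIf P p q a b x = swapIf Q p q a b x := by
  classical
  by_cases hx : P x ∧ (x p = a ∧ x q = b ∨ x p = b ∧ x q = a)
  · rw [swapIf_of_pos hx, swapIf_of_pos (hx.imp_left h.mp)]
  · rw [swapIf_of_neg hx, swapIf_of_neg (fun h' => hx (h'.imp_left h.mpr))]

theorem swapIf_apply_of_ne {P : (ι → A) → Prop} {p q i : ι} {a b : A} {x : ι → A}
    (hp : i ≠ p) (hq : i ≠ q) : swapIf P p q a b x i = x i := by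
  classical
  by_cases hx : P x ∧ (x p = a ∧ x q = b ∨ x p = b ∧ x q = a)
  · rw [swapIf_of_pos hx, comp_apply, Equiv.swap_apply_of_ne_of_ne hp hq]
  · rw [swapIf_of_neg hx]

theorem swapIf_swapIf (P : (ι → A) → Prop) {p q : ι} {a b : A} {x : ι → A}
    (h : P (swapIf P p q a b x) ↔ P x) :
    swapIf P p q a b (swapIf P p q a b x) = x := by
  classical
  by_cases hx : P x ∧ (x p = a ∧ x q = b ∨ x p = b ∧ x q = a)
  · rw [swapIf_of_pos hx] at h ⊢
    rw [swapIf_of_pos ⟨h.mpr hx.1, by simpa [or_comm, and_comm] using hx.2⟩]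
    funext i
    simp
  · rw [swapIf_of_neg hx, swapIf_of_neg hx]

theorem swapIf_update [DecidableEq ι] {P : (ι → A) → Prop} {p q i : ι} {a b v : A} {x : ι → A}
    (hp : i ≠ p) (hq : i ≠ q) :
    swapIf P p q a b (update x i v) =
      update (swapIf (fun y => P (update y i v)) p q a b x) i v := by
  by_cases hx : P (update x i v) ∧ (x p = a ∧ x q = b ∨ x p = b ∧ x q = a)
  · rw [swapIf_of_pos (by simpa [hp.symm, hq.symm] using hx),
      swapIf_of_pos (P := fun y => P (update y i v)) hx]
    funext j
    by_cases hj : j = i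
    · subst hj
      simp [Equiv.swap_apply_of_ne_of_ne hp hq]
    · have : Equiv.swap p q j ≠ i := fun h => hj (by
        rw [← Equiv.swap_apply_of_ne_of_ne hp hq] at h
        exact (Equiv.swap p q).injective h)
      simp [hj, this]
  · rw [swapIf_of_neg (by simpa [hp.symm, hq.symm] using hx),
      swapIf_of_neg (P := fun y => P (update y i v)) hx]

theorem swapIf_withAncilla (P : (Option ι → A) → Prop) (p q : ι) (a b e : A) (x : ι → A) :
    swapIf P (some p) (some q) a b (withAncilla e x) =
      withAncilla e (swapIf (fun y => P (withAncilla e y)) p q a b x) := by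
  classical
  by_cases hx : P (withAncilla e x) ∧ (x p = a ∧ x q = b ∨ x p = b ∧ x q = a)
  · rw [swapIf_of_pos hx, swapIf_of_pos (P := fun y => P (withAncilla e y)) hx]
    funext o
    rcases o with _ | j
    · simp [Equiv.swap_apply_of_ne_of_ne]
    · rw [comp_apply, (Option.some_injective ι).swap_apply]
      rfl
  · rw [swapIf_of_neg hx, swapIf_of_neg (P := fun y => P (withAncilla e y)) hx]

theorem swapIf_none_withAncilla [DecidableEq ι] {P : (Option ι → A) → Prop} {i : ι} {c d : A}
    {x : ι → A} (hP : P (withAncilla d x)) (hx : x i = c) :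
    swapIf P (some i) none c d (withAncilla d x) = withAncilla c (update x i d) := by
  rw [swapIf_of_pos (by simp [hP, hx])]
  funext o
  rcases o with _ | j
  · simp [hx]
  · by_cases hj : j = i
    · subst hj
      simp
    · simp [hj, Equiv.swap_apply_of_ne_of_ne]

theorem swapIf_none_withAncilla_of_not {P : (Option ι → A) → Prop} {i : ι} {c d : A}
    {x : ι → A} (hcd : c ≠ d) (h : ¬(P (withAncilla d x) ∧ x i = c)) :
    swapIf P (some i) none c d (withAncilla d x) = withAncilla d x :=
  swapIf_of_neg (by simpa [hcd.symm] using h)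

theorem swapIf_none_withAncilla_update [DecidableEq ι] {P : (Option ι → A) → Prop} {i : ι}
    {c d : A} {x : ι → A} (hP : P (withAncilla c (update x i d))) (hx : x i = c) :
    swapIf P (some i) none c d (withAncilla c (update x i d)) = withAncilla d x := by
  have hd : update x i d i = d := update_self _ _ _
  rw [swapIf_comm, swapIf_none_withAncilla hP hd, update_idem, ← hx, update_eq_self]

/-- Conjoining a controlled swap with one more control symbol by means of an ancilla. -/
theorem GeneratesOn.swapIf_and [Finite A] [Finite ι] {P : (ι → A) → Prop} {i p q : ι}
    {a b c d : A} (hip : i ≠ p) (hiq : i ≠ q) (hcd : c ≠ d)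
    (hP : ∀ x y : ι → A, (∀ j, j ≠ i → j ≠ p → j ≠ q → x j = y j) → (P x ↔ P y))
    (h₁ : GeneratesOn S (swapIf (fun y : Option ι → A => P (y ∘ some)) (some i) none c d))
    (h₂ : GeneratesOn S (swapIf (fun y : Option ι → A => y none = c) (some p) (some q) a b)) :
    GeneratesOn S (swapIf (fun x => P x ∧ x i = c) p q a b) := by
  classical
  refine GeneratesOn.ancilla d ((h₁.comp h₂).comp h₁) fun x => ?_
  simp only [Function.comp_apply]
  by_cases hx : P x ∧ x i = c
  · set T := swapIf (fun _ => True) p q a b x with hT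
    have hTi : T i = c := (swapIf_apply_of_ne hip hiq).trans hx.2
    have e₁ : swapIf (fun y : Option ι → A => P (y ∘ some)) (some i) none c d (withAncilla d x) =
        withAncilla c (update x i d) := swapIf_none_withAncilla hx.1 hx.2
    have e₂ : swapIf (fun y : Option ι → A => y none = c) (some p) (some q) a b
        (withAncilla c (update x i d)) = withAncilla c (update T i d) := by
      rw [swapIf_withAncilla, swapIf_update hip hiq, hT]
      congr 2
      exact swapIf_congr (by simp)
    have e₃ : swapIf (fun y : Option ι → A => P (y ∘ some)) (some i) none c d
        (withAncilla c (update T i d)) = withAncilla d T := by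
      exact swapIf_none_withAncilla_update
        ((hP _ x fun j h₁ h₂ h₃ => by simp [h₁, hT, swapIf_apply_of_ne h₂ h₃]).mpr hx.1) hTi
    rw [e₁, e₂, e₃, hT]
    exact congrArg _ (swapIf_congr (by simp [hx]))
  · have e₁ : swapIf (fun y : Option ι → A => P (y ∘ some)) (some i) none c d (withAncilla d x) =
        withAncilla d x := swapIf_none_withAncilla_of_not hcd hx
    rw [e₁, swapIf_of_neg (p := some p) (by simp [hcd.symm]), e₁, swapIf_of_neg (fun h => hx h.1)]

/-- A swap controlled by `c` arises from one controlled by a different symbol `d`, using the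
unconditional swaps. -/
theorem GeneratesOn.swapIf_control [Finite A] [Finite ι] {i p q : ι}
    {a b c d : A} (hip : i ≠ p) (hiq : i ≠ q) (hcd : c ≠ d)
    (h₁ : GeneratesOn S (swapIf (fun _ : Option ι → A => True) (some i) none c d))
    (h₂ : GeneratesOn S (swapIf (fun y : Option ι → A => y none = d) (some p) (some q) a b))
    (h₃ : GeneratesOn S (swapIf (fun _ : ι → A => True) p q a b)) :
    GeneratesOn S (swapIf (fun x : ι → A => x i = c) p q a b) := by
  classical
  have key : GeneratesOn S (swapIf (fun x : ι → A => x i ≠ c) p q a b) := by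
    refine GeneratesOn.ancilla d ((h₁.comp h₂).comp h₁) fun x => ?_
    simp only [Function.comp_apply]
    by_cases hx : x i = c
    · have e₁ : swapIf (fun _ : Option ι → A => True) (some i) none c d (withAncilla d x) =
          withAncilla c (update x i d) := swapIf_none_withAncilla trivial hx
      have e₃ : swapIf (fun _ : Option ι → A => True) (some i) none c d
          (withAncilla c (update x i d)) = withAncilla d x :=
        swapIf_none_withAncilla_update trivial hx
      rw [e₁, swapIf_of_neg (p := some p) (by simp [hcd]), e₃, swapIf_of_neg (by simp [hx])]
    · have e₁ : ∀ y : ι → A, y i ≠ c → swapIf (fun _ : Option ι → A => True) (some i) none c d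
          (withAncilla d y) = withAncilla d y := fun y hy =>
        swapIf_none_withAncilla_of_not hcd (by simp [hy])
      rw [e₁ x hx, swapIf_withAncilla, e₁ _ (by rwa [swapIf_apply_of_ne hip hiq])]
      exact congrArg _ (swapIf_congr (by simp [hx]))
  convert key.comp h₃ using 1
  funext x
  rw [Function.comp_apply]
  by_cases hx : x i = c
  · rw [swapIf_of_neg (x := swapIf _ _ _ _ _ _) (by simp [swapIf_apply_of_ne hip hiq, hx])]
    exact swapIf_congr (by simp [hx])
  · rw [swapIf_congr (P := fun x : ι → A => x i ≠ c) (Q := fun _ => True)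
      (by simp [swapIf_apply_of_ne hip hiq, hx]), swapIf_swapIf _ Iff.rfl,
      swapIf_of_neg (by simp [hx])]

/-- Changing the control symbol of a swap by conjugation with a permutation of the symbols. -/
theorem GeneratesOn.swapIf_conj_control {i p q : ι} {a b c : A} (hip : i ≠ p)
    (hiq : i ≠ q) {h : Equiv.Perm A} (hh : h * h = 1)
    (h₁ : GeneratesOn S (permIf (fun _ : ι → A => True) i h))
    (h₂ : GeneratesOn S (swapIf (fun x : ι → A => x i = c) p q a b)) :
    GeneratesOn S (swapIf (fun x : ι → A => x i = h c) p q a b) := by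
  classical
  have hh' : ∀ y, h (h y) = y := fun y => by rw [← Equiv.Perm.mul_apply, hh, Equiv.Perm.one_apply]
  convert (h₁.comp h₂).comp h₁ using 1
  funext x
  simp only [Function.comp_apply, permIf, if_true]
  rw [swapIf_update hip hiq, update_idem, update_self, hh']
  have : swapIf (fun y : ι → A => update y i (h (x i)) i = c) p q a b x =
      swapIf (fun x => x i = h c) p q a b x := swapIf_congr (by
    rw [update_self]
    exact ⟨fun h' => by rw [← h', hh'], fun h' => by rw [h', hh']⟩)
  rw [this, eq_comm]
  conv_rhs => rw [← update_eq_self i (swapIf (fun x => x i = h c) p q a b x)]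
  rw [swapIf_apply_of_ne hip hiq]

/-- Changing the exchanged symbols of a swap by conjugation with a permutation of the symbols. -/
theorem GeneratesOn.swapIf_conj {P : (ι → A) → Prop} {p q : ι} {a b : A} (hpq : p ≠ q)
    (hP : ∀ x y : ι → A, (∀ j, j ≠ p → j ≠ q → x j = y j) → (P x ↔ P y))
    {h : Equiv.Perm A} (hh : h * h = 1)
    (hp : GeneratesOn S (permIf (fun _ : ι → A => True) p h))
    (hq : GeneratesOn S (permIf (fun _ : ι → A => True) q h))
    (hs : GeneratesOn S (swapIf P p q a b)) :
    GeneratesOn S (swapIf P p q (h a) (h b)) := by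
  classical
  have hh' : ∀ y, h (h y) = y := fun y => by rw [← Equiv.Perm.mul_apply, hh, Equiv.Perm.one_apply]
  have hh'' : ∀ y z, h y = z ↔ y = h z := fun y z =>
    ⟨fun h' => by rw [← h', hh'], fun h' => by rw [h', hh']⟩
  convert ((hp.comp hq).comp hs).comp (hp.comp hq) using 1
  funext x
  simp only [Function.comp_apply, permIf, if_true]
  have hx : P (update (update x q (h (x q))) p (h (x p))) ↔ P x :=
    hP _ _ fun j h₁ h₂ => by simp [h₁, h₂]
  rw [update_of_ne hpq]
  by_cases hc : P x ∧ (x p = h a ∧ x q = h b ∨ x p = h b ∧ x q = h a)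
  · rw [swapIf_of_pos hc, swapIf_of_pos ⟨hx.mpr hc.1, by simpa [hpq.symm, hh''] using hc.2⟩]
    funext j
    by_cases hj : j = p
    · subst hj
      simp [hpq, hpq.symm, hh']
    · by_cases hj' : j = q
      · subst hj'
        simp [hpq, hpq.symm, hh']
      · simp [hj, hj', Equiv.swap_apply_of_ne_of_ne]
  · rw [swapIf_of_neg hc, swapIf_of_neg fun h' => hc ⟨hx.mp h'.1, by
      simpa [hpq.symm, hh''] using h'.2⟩]
    funext j
    by_cases hj : j = p
    · subst hj
      simp [hpq, hh']
    · by_cases hj' : j = q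
      · subst hj'
        simp [hj, hh']
      · simp [hj', hj]

/-- Changing the exchanged symbols of a controlled swap within their blocks. -/
theorem GeneratesOn.swapIf_of_block [DecidableEq A] {β : Type*} {blk : A → β} {P : (ι → A) → Prop} {p q : ι}
    {a b a' b' : A}
    (hτ : ∀ (p : ι) (a b : A), blk a = blk b →
      GeneratesOn S (permIf (fun _ : ι → A => True) p (Equiv.swap a b)))
    (hpq : p ≠ q) (hP : ∀ x y : ι → A, (∀ j, j ≠ p → j ≠ q → x j = y j) → (P x ↔ P y))
    (ha : blk a' = blk a) (hb : blk b' = blk b) (hab : blk a ≠ blk b)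
    (h : GeneratesOn S (swapIf P p q a' b')) : GeneratesOn S (swapIf P p q a b) := by
  have hne : ∀ {s t : A}, blk s ≠ blk t → s ≠ t := fun h h' => h (congrArg blk h')
  have h₁ := GeneratesOn.swapIf_conj hpq hP (Equiv.swap_mul_self a' a) (hτ p _ _ ha)
    (hτ q _ _ ha) h
  rw [Equiv.swap_apply_left, Equiv.swap_apply_of_ne_of_ne
    (hne (by rw [ha, hb]; exact hab.symm)) (hne (by rw [hb]; exact hab.symm))] at h₁
  have h₂ := GeneratesOn.swapIf_conj hpq hP (Equiv.swap_mul_self b' b) (hτ p _ _ hb)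
    (hτ q _ _ hb) h₁
  rwa [Equiv.swap_apply_left, Equiv.swap_apply_of_ne_of_ne
    (hne (by rwa [hb])) (hne hab)] at h₂

theorem permIf_apply_of_ne {P : (ι → A) → Prop} {p i : ι} {h : Equiv.Perm A} {x : ι → A}
    (hp : i ≠ p) : permIf P p h x i = x i := by
  unfold permIf
  split_ifs <;> simp [hp]

theorem permIf_withAncilla (P : (Option ι → A) → Prop) (p : ι) (h : Equiv.Perm A) (e : A)
    (x : ι → A) :
    permIf P (some p) h (withAncilla e x) =
      withAncilla e (permIf (fun y => P (withAncilla e y)) p h x) := by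
  classical
  unfold permIf
  split_ifs
  · funext o
    rcases o with _ | j
    · simp
    · by_cases hj : j = p
      · subst hj; simp
      · simp [hj]
  · rfl

theorem permIf_none_withAncilla (P : (Option ι → A) → Prop) [∀ y, Decidable (P y)]
    (h : Equiv.Perm A) (e : A) (x : ι → A) :
    permIf P none h (withAncilla e x) =
      withAncilla (if P (withAncilla e x) then h e else e) x := by
  classical
  unfold permIf
  split_ifs
  · funext o
    rcases o with _ | j <;> simp
  · rfl

/-- Conjoining two controls: the commutator of two transpositions with one common symbol, each
under one of the controls, marks on an ancilla whether both controls hold. -/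
theorem GeneratesOn.permIf_and [Finite A] [Finite ι] {P : (ι → A) → Prop} {i p : ι}
    {h : Equiv.Perm A} {c c₀ c₁ c₂ : A} (hip : i ≠ p) (h01 : c₀ ≠ c₁) (h02 : c₀ ≠ c₂)
    (h12 : c₁ ≠ c₂) (hP : ∀ x y : ι → A, (∀ j, j ≠ p → x j = y j) → (P x ↔ P y))
    (h₁ : ∀ σ : Equiv.Perm A,
      GeneratesOn S (permIf (fun y : Option ι → A => P (y ∘ some)) none σ))
    (h₂ : ∀ σ : Equiv.Perm A,
      GeneratesOn S (permIf (fun y : Option ι → A => y (some i) = c) none σ))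
    (h₃ : GeneratesOn S (permIf (fun y : Option ι → A => y none = c₂) (some p) h)) :
    GeneratesOn S (permIf (fun x => P x ∧ x i = c) p h) := by
  classical
  have g₁ := h₁ (Equiv.swap c₀ c₁)
  have g₂ := h₂ (Equiv.swap c₁ c₂)
  refine GeneratesOn.ancilla c₀ (((((((g₂.comp g₁).comp g₂).comp g₁).comp h₃).comp g₁).comp
    g₂).comp (g₁.comp g₂)) fun x => ?_
  have hwa : ∀ (e : A) (z : ι → A), withAncilla e z ∘ some = z := fun e z => rfl
  have hPx : ∀ Q : (ι → A) → Prop, P (permIf Q p h x) ↔ P x := fun Q =>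
    hP _ _ fun j hj => permIf_apply_of_ne hj
  simp only [Function.comp_apply, permIf_none_withAncilla, permIf_withAncilla, hwa,
    withAncilla_some, withAncilla_none, hPx, permIf_apply_of_ne hip]
  by_cases hx : P x <;> by_cases hi : x i = c <;>
    simp [hx, hi, permIf, Equiv.swap_apply_of_ne_of_ne, h01, h02, h02.symm, h12.symm]

theorem permIf_true_apply [DecidableEq ι] (p : ι) (h : Equiv.Perm A) (x : ι → A) :
    permIf (fun _ : ι → A => True) p h x = update x p (h (x p)) :=
  permIf_of_pos trivial

/-- Changing the control symbol of a controlled permutation by conjugation. -/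
theorem GeneratesOn.permIf_conj_control {r p : ι} {c : A} {h g : Equiv.Perm A} (hrp : r ≠ p)
    (hh : GeneratesOn S (permIf (fun _ : ι → A => True) r h))
    (hh' : GeneratesOn S (permIf (fun _ : ι → A => True) r h⁻¹))
    (hg : GeneratesOn S (permIf (fun x : ι → A => x r = c) p g)) :
    GeneratesOn S (permIf (fun x : ι → A => x r = h c) p g) := by
  classical
  convert (hh.comp hg).comp hh' using 1
  funext x
  simp only [Function.comp_apply, permIf_true_apply]
  by_cases hx : x r = h c
  · rw [permIf_of_pos hx, permIf_of_pos (by simp [hx])]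
    funext j
    by_cases hj : j = r
    · subst hj
      simp [hrp]
    · by_cases hj' : j = p
      · subst hj'
        simp [hj]
      · simp [hj, hj']
  · rw [permIf_of_neg hx, permIf_of_neg (by simpa [Equiv.symm_apply_eq] using hx)]
    simp

/-- Changing the permutation applied under a control by conjugation. -/
theorem GeneratesOn.permIf_conj {P : (ι → A) → Prop} {p : ι} {h g : Equiv.Perm A}
    (hP : ∀ x y : ι → A, (∀ j, j ≠ p → x j = y j) → (P x ↔ P y))
    (hh : GeneratesOn S (permIf (fun _ : ι → A => True) p h))
    (hh' : GeneratesOn S (permIf (fun _ : ι → A => True) p h⁻¹))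
    (hg : GeneratesOn S (permIf P p g)) :
    GeneratesOn S (permIf P p (h * g * h⁻¹)) := by
  classical
  convert (hh.comp hg).comp hh' using 1
  funext x
  simp only [Function.comp_apply, permIf_true_apply]
  have hx' : P (update x p (h⁻¹ (x p))) ↔ P x := hP _ x fun j hj => update_of_ne hj _ _
  by_cases hx : P x
  · rw [permIf_of_pos hx, permIf_of_pos (hx'.mpr hx)]
    simp
  · rw [permIf_of_neg hx, permIf_of_neg (fun h' => hx (hx'.mp h'))]
    simp

end ControlledMaps

section ControlInduction

open Function

variable {A : Type*} [Finite A] {S : Set (Gate A)} {ι : Type} [Finite ι]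

theorem GeneratesOn.permIf_of_swap [DecidableEq A] {P : (ι → A) → Prop} {p : ι}
    (hP : ∀ x y : ι → A, (∀ j, j ≠ p → x j = y j) → (P x ↔ P y))
    (h : ∀ a b : A, a ≠ b → GeneratesOn S (permIf P p (Equiv.swap a b)))
    (σ : Equiv.Perm A) : GeneratesOn S (permIf P p σ) := by
  classical
  induction σ using Equiv.Perm.swap_induction_on with
  | one =>
    convert GeneratesOn.id (S := S) (ι := ι) using 1
    funext x
    by_cases hx : P x
    · simp [permIf_of_pos hx]
    · simp [permIf_of_neg hx]
  | swap_mul σ a b hab ih =>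
    convert (h a b hab).comp ih using 1
    funext x
    rw [Function.comp_apply]
    by_cases hx : P x
    · have hx' : P (update x p (σ (x p))) :=
        (hP _ x fun j hj => update_of_ne hj _ _).mpr hx
      rw [permIf_of_pos hx, permIf_of_pos hx, permIf_of_pos hx']
      simp
    · rw [permIf_of_neg hx, permIf_of_neg hx, permIf_of_neg hx]

/-- From singly controlled permutations to permutations with any number of controls. -/
theorem generatesOn_permIf_forall {c₀ c₁ c₂ : A} (h01 : c₀ ≠ c₁) (h02 : c₀ ≠ c₂) (h12 : c₁ ≠ c₂)
    (h₀ : ∀ (ι : Type) [Finite ι] (p : ι) (g : Equiv.Perm A),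
      GeneratesOn S (permIf (fun _ : ι → A => True) p g))
    (h₁ : ∀ (ι : Type) [Finite ι] (r p : ι) (c : A) (g : Equiv.Perm A), r ≠ p →
      GeneratesOn S (permIf (fun x : ι → A => x r = c) p g))
    {n : ℕ} (s : Fin n → ι) (w : Fin n → A) {p : ι} (hs : ∀ k, s k ≠ p) (g : Equiv.Perm A) :
    GeneratesOn S (permIf (fun x : ι → A => ∀ k, x (s k) = w k) p g) := by
  induction n generalizing ι g with
  | zero =>
    convert h₀ ι p g using 3
    simp
  | succ n ih =>
    have key := GeneratesOn.permIf_and (S := S) (h := g)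
      (P := fun x : ι → A => ∀ k : Fin n, x (s k.succ) = w k.succ) (i := s 0) (c := w 0)
      (hs 0) h01 h02 h12
      (fun x y hxy => forall_congr' fun k => by rw [hxy _ (hs _)])
      (fun σ => ih (fun k => some (s k.succ)) _ (fun k => by simp) σ)
      (fun σ => h₁ (Option ι) _ _ _ σ (by simp))
      (h₁ (Option ι) _ _ _ g (by simp))
    convert key using 3 with x
    rw [Fin.forall_fin_succ, and_comm]

theorem generatesOn_of_permIf {c₀ c₁ c₂ : A} (h01 : c₀ ≠ c₁) (h02 : c₀ ≠ c₂) (h12 : c₁ ≠ c₂)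
    (h₀ : ∀ (ι : Type) [Finite ι] (p : ι) (g : Equiv.Perm A),
      GeneratesOn S (permIf (fun _ : ι → A => True) p g))
    (h₁ : ∀ (ι : Type) [Finite ι] (r p : ι) (c : A) (g : Equiv.Perm A), r ≠ p →
      GeneratesOn S (permIf (fun x : ι → A => x r = c) p g))
    (F : Equiv.Perm (ι → A)) : GeneratesOn S F := by
  classical
  have hupd : ∀ (u : ι → A) (p : ι) (b : A), GeneratesOn S (Equiv.swap u (update u p b)) := by
    intro u p b
    obtain ⟨n, ⟨e⟩⟩ := Finite.exists_equiv_fin {j // j ≠ p}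
    convert generatesOn_permIf_forall h01 h02 h12 h₀ h₁ (fun k => (e.symm k : ι))
      (fun k => u (e.symm k)) (p := p) (fun k => (e.symm k).2) (Equiv.swap (u p) b) using 1
    funext x
    have hx : (∀ k, x (e.symm k) = u (e.symm k)) ↔ x = update u p (x p) := by
      rw [e.symm.forall_congr_left, funext_iff]
      constructor
      · intro h j
        by_cases hj : j = p
        · subst hj; simp
        · simpa [hj] using h ⟨j, hj⟩
      · intro h j
        have := h (e.symm (e.symm.symm j))
        simpa [j.2] using this
    by_cases h : ∀ k, x (e.symm k) = u (e.symm k)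
    · rw [permIf_of_pos h, hx.mp h]
      have hinj : Injective fun t : A => update u p t := update_injective u p
      have := hinj.swap_apply (u p) b (x p)
      simpa using this
    · rw [permIf_of_neg h]
      refine Equiv.swap_apply_of_ne_of_ne ?_ ?_ <;> rintro rfl <;> exact h (hx.mpr (by simp))
  refine generatesOn_of_swap fun u => ?_
  have hpw : ∀ t : Finset ι, GeneratesOn S (Equiv.swap u (t.piecewise (F u) u)) := by
    intro t
    induction t using Finset.induction_on with
    | empty => simpa using GeneratesOn.id
    | insert j t _ ih =>
      rw [Finset.piecewise_insert]
      exact ih.swap_trans (hupd _ _ _)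
  have := Fintype.ofFinite ι
  simpa using hpw Finset.univ

end ControlInduction

section BlockInduction

open Function

variable {A β : Type*} [Finite A] {S : Set (Gate A)} {blk : A → β} {e : A} {ι : Type} [Finite ι]

theorem generatesOn_swapIf_true
    (hs : ∀ (ι : Type) [Finite ι] (r p q : ι) (a b : A), r ≠ p → r ≠ q → p ≠ q → blk a ≠ blk b →
      GeneratesOn S (swapIf (fun x : ι → A => x r = e) p q a b))
    {p q : ι} (hpq : p ≠ q) {a b : A} (hab : blk a ≠ blk b) :
    GeneratesOn S (swapIf (fun _ : ι → A => True) p q a b) := by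
  refine (hs (Option ι) none (some p) (some q) a b (by simp) (by simp) (by simpa) hab).ancilla e
    fun x => ?_
  rw [swapIf_withAncilla]
  exact congrArg _ (swapIf_congr (by simp))

theorem generatesOn_swapIf_apply_eq [DecidableEq A]
    (hτ : ∀ (ι : Type) [Finite ι] (p : ι) (a b : A), blk a = blk b →
      GeneratesOn S (permIf (fun _ : ι → A => True) p (Equiv.swap a b)))
    (hs : ∀ (ι : Type) [Finite ι] (r p q : ι) (a b : A), r ≠ p → r ≠ q → p ≠ q → blk a ≠ blk b →
      GeneratesOn S (swapIf (fun x : ι → A => x r = e) p q a b))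
    {r p q : ι} (hrp : r ≠ p) (hrq : r ≠ q) (hpq : p ≠ q) (c : A) {a b : A}
    (hab : blk a ≠ blk b) :
    GeneratesOn S (swapIf (fun x : ι → A => x r = c) p q a b) := by
  classical
  by_cases hc : blk c = blk e
  · have := GeneratesOn.swapIf_conj_control hrp hrq (Equiv.swap_mul_self e c)
      (hτ ι r e c hc.symm) (hs ι r p q a b hrp hrq hpq hab)
    rwa [Equiv.swap_apply_left] at this
  · exact GeneratesOn.swapIf_control hrp hrq (fun h => hc (congrArg blk h))
      (generatesOn_swapIf_true hs (by simp) hc)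
      (hs _ _ _ _ a b (by simp) (by simp) (by simpa) hab)
      (generatesOn_swapIf_true hs hpq hab)

/-- From unconditional and singly controlled swaps to swaps with any number of controls. -/
theorem generatesOn_swapIf_forall
    (hblk : ∀ a : A, ∃ b, blk a ≠ blk b)
    (h₀ : ∀ (ι : Type) [Finite ι] (p q : ι) (a b : A), p ≠ q → blk a ≠ blk b →
      GeneratesOn S (swapIf (fun _ : ι → A => True) p q a b))
    (h₁ : ∀ (ι : Type) [Finite ι] (r p q : ι) (c a b : A), r ≠ p → r ≠ q → p ≠ q →
      blk a ≠ blk b → GeneratesOn S (swapIf (fun x : ι → A => x r = c) p q a b))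
    {n : ℕ} {s : Fin n → ι} (hs : Injective s) (w : Fin n → A) {p q : ι} (hp : ∀ k, s k ≠ p)
    (hq : ∀ k, s k ≠ q) (hpq : p ≠ q) {a b : A} (hab : blk a ≠ blk b) :
    GeneratesOn S (swapIf (fun x : ι → A => ∀ k, x (s k) = w k) p q a b) := by
  induction n generalizing ι a b with
  | zero =>
    convert h₀ ι p q a b hpq hab using 2
    simp
  | succ n ih =>
    obtain ⟨d, hd⟩ := hblk (w 0)
    have hs' : ∀ k : Fin n, s k.succ ≠ s 0 := fun k h => Fin.succ_ne_zero k (hs h)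
    have key := GeneratesOn.swapIf_and (S := S) (a := a) (b := b)
      (P := fun x : ι → A => ∀ k : Fin n, x (s k.succ) = w k.succ) (i := s 0) (c := w 0) (d := d)
      (hp 0) (hq 0) (fun h => hd (congrArg blk h))
      (fun x y hxy => forall_congr' fun k => by rw [hxy _ (hs' k) (hp _) (hq _)])
      (ih (s := fun k => some (s k.succ))
        ((Option.some_injective ι).comp (hs.comp (Fin.succ_injective n))) _
        (fun k => by simpa using hs' k) (fun k => by simp) (by simp) hd)
      (h₁ (Option ι) _ _ _ _ a b (by simp) (by simp) (by simpa) hab)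
    convert key using 2
    funext x
    rw [Fin.forall_fin_succ, and_comm]

theorem generatesOn_swap_comp_swap_of_ne [DecidableEq ι] [DecidableEq (ι → A)]
    (hblk : ∀ a : A, ∃ b, blk a ≠ blk b)
    (h₀ : ∀ (ι : Type) [Finite ι] (p q : ι) (a b : A), p ≠ q → blk a ≠ blk b →
      GeneratesOn S (swapIf (fun _ : ι → A => True) p q a b))
    (h₁ : ∀ (ι : Type) [Finite ι] (r p q : ι) (c a b : A), r ≠ p → r ≠ q → p ≠ q →
      blk a ≠ blk b → GeneratesOn S (swapIf (fun x : ι → A => x r = c) p q a b))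
    (u : ι → A) {p q : ι} (h : blk (u p) ≠ blk (u q)) :
    GeneratesOn S (Equiv.swap u (u ∘ Equiv.swap p q)) := by
  have hpq : p ≠ q := fun h' => h (h' ▸ rfl)
  have hu : u p ≠ u q := fun h' => h (congrArg blk h')
  obtain ⟨n, ⟨e⟩⟩ := Finite.exists_equiv_fin {j // j ≠ p ∧ j ≠ q}
  convert generatesOn_swapIf_forall hblk h₀ h₁ (s := fun k => (e.symm k : ι))
    (Subtype.val_injective.comp e.symm.injective)
    (fun k => u (e.symm k)) (p := p) (q := q) (fun k => (e.symm k).2.1)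
    (fun k => (e.symm k).2.2) hpq h using 1
  funext x
  by_cases hx : (∀ k, x (e.symm k) = u (e.symm k)) ∧
    (x p = u p ∧ x q = u q ∨ x p = u q ∧ x q = u p)
  · rw [swapIf_of_pos hx]
    have hx' : ∀ j, j ≠ p → j ≠ q → x j = u j := fun j h₁ h₂ => by
      simpa using hx.1 (e ⟨j, h₁, h₂⟩)
    rcases hx.2 with ⟨hp, hq⟩ | ⟨hp, hq⟩
    · obtain rfl : x = u := by
        funext j
        by_cases hjp : j = p
        · rw [hjp, hp]
        · by_cases hjq : j = q
          · rw [hjq, hq]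
          · exact hx' j hjp hjq
      rw [Equiv.swap_apply_left]
    · obtain rfl : x = u ∘ Equiv.swap p q := by
        funext j
        by_cases hjp : j = p
        · simp [hjp, hp]
        · by_cases hjq : j = q
          · simp [hjq, hq]
          · simp [hx' j hjp hjq, Equiv.swap_apply_of_ne_of_ne hjp hjq]
      rw [Equiv.swap_apply_right]
      funext j
      simp
  · rw [swapIf_of_neg hx]
    refine Equiv.swap_apply_of_ne_of_ne ?_ ?_ <;> rintro rfl <;> refine hx ⟨fun k => ?_, ?_⟩
    · rfl
    · simp
    · simp [Equiv.swap_apply_of_ne_of_ne (e.symm k).2.1 (e.symm k).2.2]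
    · simp

theorem generatesOn_swap_comp_swap [DecidableEq ι] [DecidableEq (ι → A)]
    (hblk : ∀ a : A, ∃ b, blk a ≠ blk b)
    (h₀ : ∀ (ι : Type) [Finite ι] (p q : ι) (a b : A), p ≠ q → blk a ≠ blk b →
      GeneratesOn S (swapIf (fun _ : ι → A => True) p q a b))
    (h₁ : ∀ (ι : Type) [Finite ι] (r p q : ι) (c a b : A), r ≠ p → r ≠ q → p ≠ q →
      blk a ≠ blk b → GeneratesOn S (swapIf (fun x : ι → A => x r = c) p q a b))
    (u : ι → A) (p q : ι) :
    GeneratesOn S (Equiv.swap u (u ∘ Equiv.swap p q)) := by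
  classical
  by_cases h : blk (u p) = blk (u q)
  · obtain ⟨c, hc⟩ := hblk (u p)
    have hstep := @generatesOn_swap_comp_swap_of_ne A β _ S blk (Option ι) _ _ _ hblk h₀ h₁
    set v := withAncilla c u with hv
    by_cases hpq : p = q
    · subst hpq
      simpa using generatesOn_swap_self u
    have e₁ := hstep v (p := some p) (q := none) hc
    have e₂ := hstep (v ∘ Equiv.swap (some p) none) (p := some p) (q := some q) (by
      simpa [hv, Ne.symm hpq, Equiv.swap_apply_of_ne_of_ne, ← h] using hc.symm)
    have e₃ := hstep ((v ∘ Equiv.swap (some p) none) ∘ Equiv.swap (some p) (some q))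
      (p := some q) (q := none) (by
        simpa [hv, Ne.symm hpq, Equiv.swap_apply_of_ne_of_ne] using hc.symm)
    have hfin : ((v ∘ Equiv.swap (some p) none) ∘ Equiv.swap (some p) (some q)) ∘
        Equiv.swap (some q) none = withAncilla c (u ∘ Equiv.swap p q) := by
      funext o
      rcases o with _ | j
      · simp [hv]
      · by_cases hjp : j = p
        · subst hjp
          simp [hv, hpq, Ne.symm hpq, Equiv.swap_apply_of_ne_of_ne]
        · by_cases hjq : j = q
          · subst hjq
            simp [hv, Equiv.swap_apply_of_ne_of_ne]
          · simp [hv, hjp, hjq, Equiv.swap_apply_of_ne_of_ne]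
    have key := (e₁.swap_trans e₂).swap_trans e₃
    rw [hfin] at key
    refine key.ancilla c fun x => ?_
    have hinj : Injective (withAncilla c : (ι → A) → Option ι → A) := fun x y hxy => by
      funext i
      exact congrFun hxy (some i)
    exact hinj.swap_apply _ _ _
  · exact generatesOn_swap_comp_swap_of_ne hblk h₀ h₁ u h

theorem generatesOn_swap_comp_perm [DecidableEq (ι → A)]
    (h : ∀ (u : ι → A) (p q : ι) [DecidableEq ι],
      GeneratesOn S (Equiv.swap u (u ∘ Equiv.swap p q)))
    (u : ι → A) (σ : Equiv.Perm ι) :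
    GeneratesOn S (Equiv.swap u (u ∘ σ)) := by
  classical
  induction σ using Equiv.Perm.swap_induction_on generalizing u with
  | one => exact generatesOn_swap_self u
  | swap_mul σ p q _ ih => exact (h u p q).swap_trans (ih (u ∘ Equiv.swap p q))

end BlockInduction

/-- Strings with the same number of occurrences of every symbol are rearrangements of each
other. -/
theorem exists_perm_of_countOf_eq {A : Type*} [DecidableEq A] {n : ℕ} {x y : Fin n → A}
    (h : ∀ a, countOf a y = countOf a x) : ∃ σ : Equiv.Perm (Fin n), y = x ∘ σ := by
  have e : ∀ a, {i // y i = a} ≃ {i // x i = a} := fun a =>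
    Fintype.equivOfCardEq (by rw [Fintype.card_subtype, Fintype.card_subtype]; exact h a)
  refine ⟨(Equiv.sigmaFiberEquiv y).symm.trans
    ((Equiv.sigmaCongrRight e).trans (Equiv.sigmaFiberEquiv x)), ?_⟩
  funext i
  exact (e (y i) ⟨i, rfl⟩).2.symm

section BasicGates

open Function

theorem splitEquiv_symm_vec {A : Type*} (x y z : A) :
    (splitEquiv A 1 2).symm (![x], ![y, z]) = ![x, y, z] := by
  funext k
  obtain ⟨s, rfl⟩ := finSumFinEquiv.surjective k
  rw [splitEquiv_symm_apply]
  rcases s with s | s <;> fin_cases s <;> rfl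

variable {A : Type*} [DecidableEq A] {S : Set (Gate A)} {ι : Type} [Finite ι]

theorem generatesOn_permIf_true_of_tau {a b : A} (h : Generates S ⟨1, tau ![a] ![b]⟩) (p : ι) :
    GeneratesOn S (permIf (fun _ : ι → A => True) p (Equiv.swap a b)) := by
  classical
  have hj : Injective (fun _ : Fin 1 => p) := injective_of_subsingleton _
  convert h.generatesOn.extend hj using 1
  funext x
  have hx : x ∘ (fun _ : Fin 1 => p) = ![x p] := by
    funext i
    simp
  have hinj : Injective fun t : A => ![t] := fun s t hst => congrFun hst 0
  have ht : tau ![a] ![b] ![x p] = ![Equiv.swap a b (x p)] := hinj.swap_apply a b (x p)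
  rw [permIf_true_apply, hx, ht]
  funext i
  by_cases hi : i = p
  · subst hi
    rw [update_self, hj.extend_apply ![Equiv.swap a b (x i)] x 0]
    rfl
  · rw [update_of_ne hi, extend_apply' _ _ _ (by simpa using Ne.symm hi)]

theorem generatesOn_permIf_apply_eq_of_tau {a b : A}
    (h : Generates S ⟨2, tau ![a, a] ![a, b]⟩) {r p : ι} (hrp : r ≠ p) :
    GeneratesOn S (permIf (fun x : ι → A => x r = a) p (Equiv.swap a b)) := by
  classical
  have hj : Injective ![r, p] := by
    intro i j
    fin_cases i <;> fin_cases j <;> simp [hrp, hrp.symm]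
  convert h.generatesOn.extend hj using 1
  funext x
  have hx : x ∘ ![r, p] = ![x r, x p] := by
    funext i
    fin_cases i <;> rfl
  have ht : tau ![a, a] ![a, b] ![x r, x p] =
      ![x r, if x r = a then Equiv.swap a b (x p) else x p] := by
    by_cases hr : x r = a
    · have hinj : Injective fun t : A => ![a, t] := fun s t hst => congrFun hst 1
      rw [hr, if_pos rfl]
      exact hinj.swap_apply a b (x p)
    · rw [if_neg hr]
      exact Equiv.swap_apply_of_ne_of_ne (fun h' => hr (congrFun h' 0))
        (fun h' => hr (congrFun h' 0))
  rw [hx, ht]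
  funext i
  by_cases hi : i = p
  · subst hi
    refine Eq.trans ?_ (hj.extend_apply _ x 1).symm
    by_cases hr : x r = a
    · rw [permIf_of_pos hr]
      simp [hr]
    · rw [permIf_of_neg hr]
      simp [hr]
  · rw [permIf_apply_of_ne hi]
    by_cases hi' : i = r
    · subst hi'
      refine Eq.trans ?_ (hj.extend_apply _ x 0).symm
      rfl
    · rw [extend_apply']
      rintro ⟨k, hk⟩
      fin_cases k
      · exact hi' hk.symm
      · exact hi hk.symm

theorem controlled_swapGate_apply (e a b x y z : A) :
    controlled ![e] (swapGate a b) ![x, y, z] =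
      if x = e ∧ (y = a ∧ z = b ∨ y = b ∧ z = a) then ![x, z, y] else ![x, y, z] := by
  rw [← splitEquiv_symm_vec x y z, ← splitEquiv_symm_vec x z y]
  simp only [controlled, Equiv.trans_apply, Equiv.apply_symm_apply,
    Equiv.prodCongrRight_apply]
  by_cases hx : x = e
  · subst hx
    have hs : swapGate a b ![y, z] =
        if y = a ∧ z = b ∨ y = b ∧ z = a then ![z, y] else ![y, z] := by
      have hv : ∀ s t : A, ![y, z] = ![s, t] ↔ y = s ∧ z = t := fun s t => by
        constructor
        · intro h'
          exact ⟨congrFun h' 0, congrFun h' 1⟩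
        · rintro ⟨rfl, rfl⟩
          rfl
      simp only [swapGate, tau, Equiv.swap_apply_def, hv]
      split_ifs <;> grind
    simp only [if_true, hs, true_and]
    split_ifs <;> rfl
  · have : ¬(![x] = ![e]) := fun h' => hx (congrFun h' 0)
    simp [hx]

theorem generatesOn_swapIf_of_controlled {e a b : A}
    (h : Generates S ⟨1 + 2, controlled ![e] (swapGate a b)⟩) {r p q : ι} (hrp : r ≠ p)
    (hrq : r ≠ q) (hpq : p ≠ q) :
    GeneratesOn S (swapIf (fun x : ι → A => x r = e) p q a b) := by
  classical
  have hj : Injective (![r, p, q] : Fin (1 + 2) → ι) := by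
    intro i j
    fin_cases i <;> fin_cases j <;> simp [hrp, hrq, hpq, hrp.symm, hrq.symm, hpq.symm]
  convert h.generatesOn.extend hj using 1
  funext x
  have hx : x ∘ (![r, p, q] : Fin (1 + 2) → ι) = ![x r, x p, x q] := by
    funext i
    fin_cases i <;> rfl
  rw [hx, controlled_swapGate_apply]
  funext i
  by_cases hir : i = r
  · subst hir
    rw [swapIf_apply_of_ne hrp hrq]
    refine Eq.trans ?_ (hj.extend_apply _ x 0).symm
    split_ifs <;> rfl
  · by_cases hip : i = p
    · subst hip
      refine Eq.trans ?_ (hj.extend_apply _ x 1).symm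
      split_ifs with hc
      · rw [swapIf_of_pos hc]
        simp
      · rw [swapIf_of_neg hc]
        rfl
    · by_cases hiq : i = q
      · subst hiq
        refine Eq.trans ?_ (hj.extend_apply _ x 2).symm
        split_ifs with hc
        · rw [swapIf_of_pos hc]
          simp
        · rw [swapIf_of_neg hc]
          rfl
      · rw [swapIf_apply_of_ne hip hiq, extend_apply']
        rintro ⟨k, hk⟩
        fin_cases k
        · exact hir hk.symm
        · exact hip hk.symm
        · exact hiq hk.symm

end BasicGates

/-- Here `λ` is a partition of `A = {1,…,k}` (`k ≥ 3`) given by disjoint nonempty blocks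
`B i` covering `A`, and `S` is the generating set consisting of (1) `τ_{a,b}` for all
`a ≠ b` in a common block, (2) `τ_{aa,ab}` for one chosen pair `a = ca i ≠ cb i = b` in
each block of size `> 1`, and (3) `1-SWAP_{a,b}` for one chosen pair `a = da i j ∈ B i`,
`b = db i j ∈ B j` for each `i < j`.
Then `S` generates `CONS`, the class of all conservative gates: `CONS ⊆ ⟨S⟩`. -/
theorem cons_subset_closure (k l : ℕ) (hk : 3 ≤ k)
    (B : Fin l → Finset (Fin k))
    (hne : ∀ i, (B i).Nonempty)
    (hdisj : ∀ i j, i ≠ j → Disjoint (B i) (B j))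
    (hcover : ∀ x : Fin k, ∃ i, x ∈ B i)
    (ca cb : Fin l → Fin k)
    (hc : ∀ i, 1 < (B i).card → ca i ∈ B i ∧ cb i ∈ B i ∧ ca i ≠ cb i)
    (da db : Fin l → Fin l → Fin k)
    (hd : ∀ i j, i < j → da i j ∈ B i ∧ db i j ∈ B j) :
    {g : Gate (Fin k) | ∀ (x : Fin g.1 → Fin k) (a : Fin k),
        countOf a (g.2 x) = countOf a x} ⊆
      genClosure ({g : Gate (Fin k) | ∃ (i : Fin l) (a b : Fin k),
        a ∈ B i ∧ b ∈ B i ∧ a ≠ b ∧ g = ⟨1, tau ![a] ![b]⟩} ∪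
      {g : Gate (Fin k) | ∃ i : Fin l, 1 < (B i).card ∧
        g = ⟨2, tau ![ca i, ca i] ![ca i, cb i]⟩} ∪
      {g : Gate (Fin k) | ∃ i j : Fin l, i < j ∧
        g = ⟨1 + 2, controlled ![(⟨0, by omega⟩ : Fin k)]
          (swapGate (da i j) (db i j))⟩}) := by
  rintro ⟨n, F⟩ hF
  refine GeneratesOn.generates ?_
  set S := {g : Gate (Fin k) | ∃ (i : Fin l) (a b : Fin k),
        a ∈ B i ∧ b ∈ B i ∧ a ≠ b ∧ g = ⟨1, tau ![a] ![b]⟩} ∪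
      {g : Gate (Fin k) | ∃ i : Fin l, 1 < (B i).card ∧
        g = ⟨2, tau ![ca i, ca i] ![ca i, cb i]⟩} ∪
      {g : Gate (Fin k) | ∃ i j : Fin l, i < j ∧
        g = ⟨1 + 2, controlled ![(⟨0, by omega⟩ : Fin k)]
          (swapGate (da i j) (db i j))⟩}
  choose blk hblk using hcover
  have huniq : ∀ {a i}, a ∈ B i → blk a = i := fun {a i} ha => by
    by_contra hi
    exact Finset.disjoint_left.mp (hdisj _ _ hi) (hblk a) ha
  have hτ : ∀ (ι : Type) [Finite ι] (p : ι) (a b : Fin k), blk a = blk b →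
      GeneratesOn S (permIf (fun _ : ι → Fin k => True) p (Equiv.swap a b)) := by
    intro ι _ p a b hab
    by_cases h : a = b
    · subst h
      convert GeneratesOn.id (S := S) (ι := ι) using 1
      classical
      funext x
      simp [permIf_true_apply]
    · exact generatesOn_permIf_true_of_tau
        (Generates.mem (Or.inl (Or.inl ⟨blk a, a, b, hblk a, hab ▸ hblk b, h, rfl⟩))) p
  by_cases hsingle : ∀ a b, blk a = blk b
  · let c₀ : Fin k := ⟨0, by omega⟩
    let i := blk c₀
    have hcard : 1 < (B i).card := Finset.one_lt_card.mpr
      ⟨c₀, hblk c₀, ⟨1, by omega⟩, hsingle ⟨1, by omega⟩ c₀ ▸ hblk ⟨1, by omega⟩, by simp [c₀]⟩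
    obtain ⟨-, -, hcab⟩ := hc i hcard
    have h₀ : ∀ (ι : Type) [Finite ι] (p : ι) (g : Equiv.Perm (Fin k)),
        GeneratesOn S (permIf (fun _ : ι → Fin k => True) p g) := fun ι _ p =>
      GeneratesOn.permIf_of_swap (fun _ _ _ => Iff.rfl) fun a b _ => hτ ι p a b (hsingle a b)
    refine generatesOn_of_permIf (c₀ := c₀) (c₁ := ⟨1, by omega⟩) (c₂ := ⟨2, by omega⟩)
      (by simp [c₀]) (by simp [c₀]) (by simp) h₀ (fun ι _ r p c g hrp => ?_) F
    have hP : ∀ x y : ι → Fin k, (∀ j, j ≠ p → x j = y j) → (x r = c ↔ y r = c) :=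
      fun x y hxy => by rw [hxy r hrp]
    refine GeneratesOn.permIf_of_swap hP (fun a b hab => ?_) g
    have h₁ := generatesOn_permIf_apply_eq_of_tau
      (Generates.mem (S := S) (Or.inl (Or.inr ⟨i, hcard, rfl⟩))) hrp
    have h₂ := GeneratesOn.permIf_conj_control hrp (h₀ ι r (Equiv.swap (ca i) c)) (h₀ ι r _) h₁
    rw [Equiv.swap_apply_left] at h₂
    obtain ⟨σ, hσ⟩ := isConj_iff.mp (Equiv.Perm.isConj_swap hcab hab)
    rw [← hσ]
    exact GeneratesOn.permIf_conj hP (h₀ ι p σ) (h₀ ι p _) h₂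
  · push Not at hsingle
    obtain ⟨s, t, hst⟩ := hsingle
    have hother : ∀ a, ∃ b, blk a ≠ blk b := fun a => by
      by_cases h : blk a = blk s
      · exact ⟨t, h ▸ hst⟩
      · exact ⟨s, h⟩
    have hlt : ∀ (ι : Type) [Finite ι] (r p q : ι) (a b : Fin k), r ≠ p → r ≠ q → p ≠ q →
        blk a < blk b →
        GeneratesOn S (swapIf (fun x : ι → Fin k => x r = ⟨0, by omega⟩) p q a b) := by
      intro ι _ r p q a b hrp hrq hpq hab
      obtain ⟨ha, hb⟩ := hd _ _ hab
      exact GeneratesOn.swapIf_of_block (hτ ι) hpq (fun x y hxy => by rw [hxy r hrp hrq])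
        (huniq ha) (huniq hb) hab.ne
        (generatesOn_swapIf_of_controlled (Generates.mem (Or.inr ⟨_, _, hab, rfl⟩)) hrp hrq hpq)
    have hs : ∀ (ι : Type) [Finite ι] (r p q : ι) (a b : Fin k), r ≠ p → r ≠ q → p ≠ q →
        blk a ≠ blk b →
        GeneratesOn S (swapIf (fun x : ι → Fin k => x r = ⟨0, by omega⟩) p q a b) := by
      intro ι _ r p q a b hrp hrq hpq hab
      rcases hab.lt_or_gt with h | h
      · exact hlt ι r p q a b hrp hrq hpq h
      · rw [swapIf_comm]
        exact hlt ι r p q b a hrp hrq hpq h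
    refine generatesOn_of_swap fun u => ?_
    obtain ⟨σ, hσ⟩ := exists_perm_of_countOf_eq (hF u)
    rw [hσ]
    exact generatesOn_swap_comp_perm (fun u p q _ => generatesOn_swap_comp_swap hother
      (fun ι _ p q a b hpq hab => generatesOn_swapIf_true hs hpq hab)
      (fun ι _ r p q c a b hrp hrq hpq hab =>
        generatesOn_swapIf_apply_eq hτ hs hrp hrq hpq c hab) u p q) u σ
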